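/- Fix d ≥ 1, T > 0, a compact interval Θ = [θ_min, θ_max] ⊂ (0,∞), a link function Φ, an integer β > 2 + d/2, R > 0, and a smooth ℤ^d-periodic initial value u_0. Fix θ₀ ∈ Θ and a smooth ℤ^d-periodic F₀, and let u* be a smooth classical solution with diffusivity θ₀, absorption Φ∘F₀ and initial value u_0 with inf u* > 0. Assume the solution map is injective at (θ₀, F₀): whenever θ ∈ Θ, F is a continuous ℤ^d-periodic function, and u is a smooth classical solution with diffusivity θ, absorption Φ∘F and initial value u_0 satisfying u = u*, then θ = θ₀ and F = F₀. Then for every sequence (θ_m, F_m) with θ_m ∈ Θ, F_m smooth ℤ^d-periodic with ‖F_m‖_{H^β(𝕋^d)} ≤ R, and smooth classical solutions u_m with diffusivity θ_m, absorption Φ∘F_m and initial value u_0 such that ‖u_m − u*‖_{H^{2,1}(Q)} → 0 as m → ∞, one has θ_m → θ₀ and ‖F_m − F₀‖_{L²(𝕋^d)} → 0. (The inversion lemma used to globalize the stability estimate.) -/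

import Mathlib

open MeasureTheory Real Filter

noncomputable section

/-- Partial derivative in the `i`-th spatial coordinate. -/
def pder {d : ℕ} (i : Fin d) (v : (Fin d → ℝ) → ℝ) : (Fin d → ℝ) → ℝ :=
  fun x => deriv (fun s => v (Function.update x i s)) (x i)

/-- Spatial Laplacian `Δ_x = ∑ᵢ ∂²/∂xᵢ²`. -/
def lap {d : ℕ} (v : (Fin d → ℝ) → ℝ) : (Fin d → ℝ) → ℝ :=
  fun x => ∑ i : Fin d, pder i (pder i v) x

/-- Multi-index spatial derivative `∂^j`. -/
def mder {d : ℕ} (j : Fin d → ℕ) (v : (Fin d → ℝ) → ℝ) : (Fin d → ℝ) → ℝ :=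
  (List.finRange d).foldr (fun i acc => (pder i)^[j i] acc) v

/-- `ℤ^d`-periodicity of a function on `ℝ^d`. -/
def ZPer {d : ℕ} (F : (Fin d → ℝ) → ℝ) : Prop :=
  ∀ (x : Fin d → ℝ) (k : Fin d → ℤ), F (fun i => x i + (k i : ℝ)) = F x

/-- `ℤ^d`-periodicity in the space variable. -/
def ZPerSpace {d : ℕ} (u : (Fin d → ℝ) → ℝ → ℝ) : Prop :=
  ∀ t : ℝ, ZPer fun x => u x t

/-- The fundamental domain `[0,1]^d` of the torus. -/
def unitCube (d : ℕ) : Set (Fin d → ℝ) := Set.Icc 0 1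

/-- `L²`-norm on the torus. -/
def l2T {d : ℕ} (F : (Fin d → ℝ) → ℝ) : ℝ :=
  Real.sqrt (∫ x in unitCube d, (F x) ^ 2)

/-- `L²`-norm on `Q = 𝕋^d × (0,T)`. -/
def l2Q {d : ℕ} (T : ℝ) (u : (Fin d → ℝ) → ℝ → ℝ) : ℝ :=
  Real.sqrt (∫ t in Set.Ioc (0 : ℝ) T, ∫ x in unitCube d, (u x t) ^ 2)

/-- Supremum norm over space. -/
def supT {d : ℕ} (F : (Fin d → ℝ) → ℝ) : ℝ := ⨆ x, |F x|

/-- Supremum norm over `𝕋^d × [0,T]`. -/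
def supQ {d : ℕ} (T : ℝ) (u : (Fin d → ℝ) → ℝ → ℝ) : ℝ :=
  ⨆ x, ⨆ t ∈ Set.Icc (0 : ℝ) T, |u x t|

/-- Squared Sobolev `H^β`-norm on the torus:  `∑_{|j| ≤ β} ‖∂^j F‖²_{L²(𝕋^d)}`. -/
def hSobSq {d : ℕ} (β : ℕ) (F : (Fin d → ℝ) → ℝ) : ℝ :=
  ∑ j ∈ Finset.univ.filter (fun j : Fin d → Fin (β + 1) => (∑ i, (j i : ℕ)) ≤ β),
    ∫ x in unitCube d, (mder (fun i => (j i : ℕ)) F x) ^ 2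

/-- Sobolev `H^β`-norm on the torus. -/
def hSob {d : ℕ} (β : ℕ) (F : (Fin d → ℝ) → ℝ) : ℝ := Real.sqrt (hSobSq β F)

/-- Squared parabolic Sobolev `H^{2,1}(Q)`-norm. -/
def h21Sq {d : ℕ} (T : ℝ) (u : (Fin d → ℝ) → ℝ → ℝ) : ℝ :=
  (∫ t in Set.Ioc (0 : ℝ) T,
      ∑ j ∈ Finset.univ.filter (fun j : Fin d → Fin 3 => (∑ i, (j i : ℕ)) ≤ 2),
        ∫ x in unitCube d, (mder (fun i => (j i : ℕ)) (fun y => u y t) x) ^ 2)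
    + ∫ x in unitCube d, ∫ t in Set.Ioc (0 : ℝ) T, ((u x t) ^ 2 + (deriv (u x) t) ^ 2)

/-- Parabolic Sobolev `H^{2,1}(Q)`-norm. -/
def h21 {d : ℕ} (T : ℝ) (u : (Fin d → ℝ) → ℝ → ℝ) : ℝ := Real.sqrt (h21Sq T u)

/-- Smoothness of a function of space and time. -/
def SmoothQ {d : ℕ} (u : (Fin d → ℝ) → ℝ → ℝ) : Prop :=
  ContDiff ℝ (⊤ : ℕ∞) fun p : (Fin d → ℝ) × ℝ => u p.1 p.2

/-- A smooth classical solution of the heat equation with absorption `f`,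
diffusivity `θ` and initial value `u0`. -/
def HeatSol {d : ℕ} (T θ : ℝ) (f u0 : (Fin d → ℝ) → ℝ) (u : (Fin d → ℝ) → ℝ → ℝ) : Prop :=
  SmoothQ u ∧ ZPerSpace u ∧
    (∀ (x : Fin d → ℝ), ∀ t ∈ Set.Ioc (0 : ℝ) T,
      deriv (u x) t = θ / 2 * lap (fun y => u y t) x - f x * u x t) ∧
    ∀ x, u x 0 = u0 x

/-- A smooth solution of the inhomogeneous problem with forcing `g` and
zero initial value (`v = 𝓛_{θ,f}⁻¹ g`). -/
def InhomSol {d : ℕ} (T θ : ℝ) (f : (Fin d → ℝ) → ℝ) (g v : (Fin d → ℝ) → ℝ → ℝ) : Prop :=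
  SmoothQ v ∧ ZPerSpace v ∧
    (∀ (x : Fin d → ℝ), ∀ t ∈ Set.Ioc (0 : ℝ) T,
      deriv (v x) t = θ / 2 * lap (fun y => v y t) x - f x * v x t + g x t) ∧
    ∀ x, v x 0 = 0

/-- A link function: a smooth function `Φ : ℝ → (fmin, ∞)` with strictly positive
derivative and all derivatives bounded. -/
structure LinkFun where
  toFun : ℝ → ℝ
  fmin : ℝ
  fmin_pos : 0 < fmin
  smooth : ContDiff ℝ (⊤ : ℕ∞) toFun
  gt_fmin : ∀ x, fmin < toFun x
  deriv_pos : ∀ x, 0 < deriv toFun x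
  derivs_bdd : ∀ n : ℕ, 1 ≤ n → ∃ C, ∀ x, |iteratedDeriv n toFun x| ≤ C

/-- The linearized solution `I_{θ,F} h` in direction `h`, associated with a solution `u`. -/
def LinSol {d : ℕ} (T θ : ℝ) (Φ : LinkFun) (F h : (Fin d → ℝ) → ℝ)
    (u z : (Fin d → ℝ) → ℝ → ℝ) : Prop :=
  SmoothQ z ∧ ZPerSpace z ∧
    (∀ (x : Fin d → ℝ), ∀ t ∈ Set.Ioc (0 : ℝ) T,
      deriv (z x) t = θ / 2 * lap (fun y => z y t) x - Φ.toFun (F x) * z x t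
        + h x * deriv Φ.toFun (F x) * u x t) ∧
    ∀ x, z x 0 = 0

/-- The `θ`-derivative solution `K̇_θ F`, associated with a solution `u`. -/
def ThetaDerivSol {d : ℕ} (T θ : ℝ) (Φ : LinkFun) (F : (Fin d → ℝ) → ℝ)
    (u w : (Fin d → ℝ) → ℝ → ℝ) : Prop :=
  SmoothQ w ∧ ZPerSpace w ∧
    (∀ (x : Fin d → ℝ), ∀ t ∈ Set.Ioc (0 : ℝ) T,
      deriv (w x) t = θ / 2 * lap (fun y => w y t) x - Φ.toFun (F x) * w x t
        + 1 / 2 * lap (fun y => u y t) x) ∧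
    ∀ x, w x 0 = 0

/-- Dual Sobolev norm `‖G‖_{(H²)*}` on the torus. -/
def h2dual {d : ℕ} (G : (Fin d → ℝ) → ℝ) : ℝ :=
  sSup {r : ℝ | ∃ g : (Fin d → ℝ) → ℝ, ContDiff ℝ (⊤ : ℕ∞) g ∧ ZPer g ∧ hSob 2 g ≤ 1 ∧
    r = |∫ x in unitCube d, G x * g x|}

end

open scoped ContDiff Topology

section Calculus

variable {d : ℕ}

lemma pder_eq_fderiv {v : (Fin d → ℝ) → ℝ} {x : Fin d → ℝ} (hv : DifferentiableAt ℝ v x)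
    (i : Fin d) : pder i v x = fderiv ℝ v x (Pi.single i 1) := by
  have h : HasFDerivAt v (fderiv ℝ v x) (Function.update x i (x i)) := by
    simpa using hv.hasFDerivAt
  exact (h.comp_hasDerivAt (x i) (hasDerivAt_update x i (x i))).deriv

lemma ContDiff.pder {v : (Fin d → ℝ) → ℝ} (hv : ContDiff ℝ ∞ v) (i : Fin d) :
    ContDiff ℝ ∞ (pder i v) := by
  have h : _root_.pder i v = fun x => fderiv ℝ v x (Pi.single i 1) :=
    funext fun x => pder_eq_fderiv (hv.differentiable (by simp) x) i
  rw [h]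
  exact (hv.fderiv_right (m := ∞) (by simp)).clm_apply contDiff_const

lemma ContDiff.pder_iterate {v : (Fin d → ℝ) → ℝ} (hv : ContDiff ℝ ∞ v) (i : Fin d) (n : ℕ) :
    ContDiff ℝ ∞ ((_root_.pder i)^[n] v) := by
  induction n with
  | zero => exact hv
  | succ n ih => rw [Function.iterate_succ_apply']; exact ih.pder i

lemma ZPer.pder {v : (Fin d → ℝ) → ℝ} (hv : Differentiable ℝ v) (hp : ZPer v) (i : Fin d) :
    ZPer (pder i v) := by
  intro x k
  rw [pder_eq_fderiv (hv _), pder_eq_fderiv (hv _)]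
  have h := fderiv_comp_add_right (𝕜 := ℝ) (f := v) (x := x) (fun i => (k i : ℝ))
  have h' : (fun y => v (y + fun i => (k i : ℝ))) = v := funext fun y => hp y k
  rw [h'] at h
  rw [h]
  rfl

lemma ZPer.pder_iterate {v : (Fin d → ℝ) → ℝ} (hv : ContDiff ℝ ∞ v) (hp : ZPer v) (i : Fin d)
    (n : ℕ) : ZPer ((_root_.pder i)^[n] v) := by
  induction n with
  | zero => exact hp
  | succ n ih =>
    rw [Function.iterate_succ_apply']
    exact ih.pder ((hv.pder_iterate i n).differentiable (by simp)) i

lemma pder_sub {v w : (Fin d → ℝ) → ℝ} (hv : Differentiable ℝ v) (hw : Differentiable ℝ w)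
    (i : Fin d) : pder i (fun x => v x - w x) = fun x => pder i v x - pder i w x := by
  funext x
  rw [pder_eq_fderiv (hv x), pder_eq_fderiv (hw x), pder_eq_fderiv ((hv x).fun_sub (hw x)),
    fderiv_fun_sub (hv x) (hw x)]
  rfl

lemma lap_sub {v w : (Fin d → ℝ) → ℝ} (hv : ContDiff ℝ ∞ v) (hw : ContDiff ℝ ∞ w)
    (x : Fin d → ℝ) : lap (fun x => v x - w x) x = lap v x - lap w x := by
  have key : ∀ i, pder i (pder i fun x => v x - w x) x
      = pder i (pder i v) x - pder i (pder i w) x := fun i => by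
    rw [pder_sub (hv.differentiable (by simp)) (hw.differentiable (by simp)),
      pder_sub ((hv.pder i).differentiable (by simp)) ((hw.pder i).differentiable (by simp))]
  simp only [lap, key, Finset.sum_sub_distrib]

lemma foldr_pder_single (i : Fin d) (n : ℕ) (v : (Fin d → ℝ) → ℝ) (l : List (Fin d))
    (hl : l.Nodup) :
    l.foldr (fun i' acc => (pder i')^[(Pi.single i n : Fin d → ℕ) i'] acc) v
      = if i ∈ l then (pder i)^[n] v else v := by
  induction l with
  | nil => simp
  | cons a l ih =>
    rw [List.nodup_cons] at hl
    rw [List.foldr_cons, ih hl.2]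
    by_cases h : a = i
    · subst h
      simp [hl.1]
    · simp [h, Ne.symm h]

lemma mder_single (i : Fin d) (n : ℕ) (v : (Fin d → ℝ) → ℝ) :
    mder (Pi.single i n) v = (pder i)^[n] v := by
  rw [mder, foldr_pder_single i n v _ (List.nodup_finRange d)]
  simp

lemma mder_zero (v : (Fin d → ℝ) → ℝ) : mder 0 v = v := by
  rw [mder]
  induction List.finRange d with
  | nil => rfl
  | cons a l ih => simp

lemma ZPer.lap {v : (Fin d → ℝ) → ℝ} (hv : ContDiff ℝ ∞ v) (hp : ZPer v) : ZPer (lap v) := by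
  intro x k
  exact Finset.sum_congr rfl fun i _ => hp.pder_iterate hv i 2 x k

end Calculus

section SpaceTime

variable {d : ℕ} {u w : (Fin d → ℝ) → ℝ → ℝ}

lemma SmoothQ.contDiff_space (hu : SmoothQ u) (t : ℝ) : ContDiff ℝ ∞ fun x => u x t :=
  ContDiff.comp (g := fun p : (Fin d → ℝ) × ℝ => u p.1 p.2) hu
    (contDiff_id.prodMk contDiff_const)

lemma SmoothQ.contDiff_time (hu : SmoothQ u) (x : Fin d → ℝ) : ContDiff ℝ ∞ (u x) :=
  ContDiff.comp (g := fun p : (Fin d → ℝ) × ℝ => u p.1 p.2) hu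
    (contDiff_const.prodMk contDiff_id)

lemma SmoothQ.sub (hu : SmoothQ u) (hw : SmoothQ w) : SmoothQ fun x t => u x t - w x t :=
  ContDiff.sub hu hw

lemma SmoothQ.pder (hu : SmoothQ u) (i : Fin d) : SmoothQ fun x t => pder i (fun y => u y t) x := by
  have h : (fun p : (Fin d → ℝ) × ℝ => _root_.pder i (fun y => u y p.2) p.1)
      = fun p => fderiv ℝ (fun p : (Fin d → ℝ) × ℝ => u p.1 p.2) p (Pi.single i 1, 0) := by
    funext ⟨x, t⟩
    have hf := (ContDiff.differentiable hu (by simp) (x, t)).hasFDerivAt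
    have hx : HasFDerivAt (fun y : Fin d → ℝ => (y, t))
        (ContinuousLinearMap.inl ℝ (Fin d → ℝ) ℝ) x := hasFDerivAt_prodMk_left x t
    have hc : HasFDerivAt (fun y => u y t) _ x :=
      HasFDerivAt.comp (g := fun p : (Fin d → ℝ) × ℝ => u p.1 p.2) x hf hx
    rw [pder_eq_fderiv ((hu.contDiff_space t).differentiable (by simp) x), hc.fderiv]
    simp
  unfold SmoothQ
  rw [h]
  exact (ContDiff.fderiv_right (m := ∞) hu (by simp)).clm_apply contDiff_const

lemma SmoothQ.pder_iterate (hu : SmoothQ u) (i : Fin d) (n : ℕ) :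
    SmoothQ fun x t => (_root_.pder i)^[n] (fun y => u y t) x := by
  induction n with
  | zero => exact hu
  | succ n ih => simpa only [Function.iterate_succ_apply'] using ih.pder i

lemma SmoothQ.mder (hu : SmoothQ u) (j : Fin d → ℕ) :
    SmoothQ fun x t => mder j (fun y => u y t) x := by
  simp only [_root_.mder]
  induction List.finRange d with
  | nil => exact hu
  | cons a l ih => exact ih.pder_iterate a _

lemma SmoothQ.lap (hu : SmoothQ u) : SmoothQ fun x t => lap (fun y => u y t) x :=
  ContDiff.sum fun i _ => hu.pder_iterate i 2

lemma SmoothQ.deriv_time (hu : SmoothQ u) : SmoothQ fun x t => deriv (u x) t := by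
  have h : (fun p : (Fin d → ℝ) × ℝ => deriv (u p.1) p.2)
      = fun p => fderiv ℝ (fun p : (Fin d → ℝ) × ℝ => u p.1 p.2) p (0, 1) := by
    funext ⟨x, t⟩
    have hf := (ContDiff.differentiable hu (by simp) (x, t)).hasFDerivAt
    have hx : HasDerivAt (fun s : ℝ => (x, s)) ((0, 1) : (Fin d → ℝ) × ℝ) t :=
      (hasDerivAt_const t x).prodMk (hasDerivAt_id t)
    exact (hf.comp_hasDerivAt t hx).deriv
  unfold SmoothQ
  rw [h]
  exact (ContDiff.fderiv_right (m := ∞) hu (by simp)).clm_apply contDiff_const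

end SpaceTime

section Fourier

open UnitAddTorus

attribute [local instance] instMeasureSpaceUnitAddCircle

/-- The normalized Haar measure on `ℝ / ℤ` is a probability measure. -/
local instance isProbabilityMeasure_unitAddCircle :
    IsProbabilityMeasure (volume : Measure UnitAddCircle) :=
  inferInstanceAs (IsProbabilityMeasure AddCircle.haarAddCircle)

variable {d : ℕ}

lemma isCompact_unitCube (d : ℕ) : IsCompact (unitCube d) := isCompact_Icc

lemma integral_fderiv_single_eq_zero {G : (Fin d → ℝ) → ℂ} (hG : ContDiff ℝ 1 G)
    (hp : ∀ (x : Fin d → ℝ) (k : Fin d → ℤ), G (fun i => x i + (k i : ℝ)) = G x) (i : Fin d) :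
    ∫ x in unitCube d, fderiv ℝ G x (Pi.single i 1) = 0 := by
  cases d with
  | zero => exact i.elim0
  | succ n =>
    have hc : Continuous fun x => fderiv ℝ G x (Pi.single i 1) :=
      (hG.continuous_fderiv (by simp)).clm_apply continuous_const
    have hsum : ∀ x, ∑ j, (if j = i then fderiv ℝ G x else 0) (Pi.single j 1)
        = fderiv ℝ G x (Pi.single i 1) := fun x => by
      rw [Finset.sum_eq_single i] <;> simp +contextual
    have key := integral_divergence_of_hasFDerivAt_off_countable' (0 : Fin (n + 1) → ℝ) 1
      zero_le_one (fun j => if j = i then G else 0)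
      (fun j x => if j = i then fderiv ℝ G x else 0) ∅ Set.countable_empty
      (fun j => by
        split_ifs
        · exact hG.continuous.continuousOn
        · exact continuousOn_const)
      (fun x _ j => by
        split_ifs
        · exact (hG.differentiable (by simp) x).hasFDerivAt
        · exact hasFDerivAt_const _ _)
      (by
        simp only [hsum]
        exact hc.continuousOn.integrableOn_compact isCompact_Icc)
    simp only [hsum] at key
    rw [unitCube, key]
    refine Finset.sum_eq_zero fun j _ => sub_eq_zero.2 (integral_congr_ae (.of_forall fun x => ?_))
    by_cases hj : j = i
    · subst hj
      simp only [if_true]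
      rw [← hp (j.insertNth ((0 : Fin (n + 1) → ℝ) j) x) (Pi.single j 1)]
      congr 1
      funext l
      rcases Fin.eq_self_or_eq_succAbove j l with rfl | ⟨m, rfl⟩ <;> simp
    · simp [hj]

/-- The exponential monomial `x ↦ exp (2 π i ⟨k, x⟩)` on `ℝ^d`. -/
noncomputable def expMonomial (k : Fin d → ℤ) (x : Fin d → ℝ) : ℂ :=
  mFourier k fun i => (x i : UnitAddCircle)

lemma expMonomial_eq (k : Fin d → ℤ) (x : Fin d → ℝ) :
    expMonomial k x = Complex.exp (2 * π * Complex.I *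
      ((∑ i, (k i : ℝ) • ContinuousLinearMap.proj (R := ℝ) (φ := fun _ : Fin d => ℝ) i :
        (Fin d → ℝ) →L[ℝ] ℝ) x : ℝ)) := by
  simp only [expMonomial, mFourier, ContinuousMap.coe_mk, fourier_coe_apply, ← Complex.exp_sum]
  congr 1
  simp [Finset.mul_sum, mul_assoc]

lemma contDiff_expMonomial (k : Fin d → ℤ) : ContDiff ℝ ∞ (expMonomial k) := by
  rw [funext (expMonomial_eq k)]
  exact (contDiff_const.mul (Complex.ofRealCLM.contDiff.comp
    (ContinuousLinearMap.contDiff _))).cexp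

lemma fderiv_expMonomial (k : Fin d → ℤ) (x : Fin d → ℝ) (i : Fin d) :
    fderiv ℝ (expMonomial k) x (Pi.single i 1) = 2 * π * Complex.I * k i * expMonomial k x := by
  set L : (Fin d → ℝ) →L[ℝ] ℝ :=
    ∑ i, (k i : ℝ) • ContinuousLinearMap.proj (R := ℝ) (φ := fun _ : Fin d => ℝ) i with hL
  have h1 : HasFDerivAt (fun x => ((L x : ℝ) : ℂ)) (Complex.ofRealCLM.comp L) x :=
    (Complex.ofRealCLM.comp L).hasFDerivAt
  have h2 := (h1.const_mul (2 * π * Complex.I)).cexp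
  have h3 : expMonomial k = fun x => Complex.exp (2 * π * Complex.I * (L x : ℝ)) :=
    funext (expMonomial_eq k)
  have h4 : L (Pi.single i 1) = k i := by
    simp [hL, Pi.single_apply]
  rw [h3, h2.fderiv]
  simp [h4]
  ring

lemma expMonomial_periodic (k : Fin d → ℤ) (x : Fin d → ℝ) (l : Fin d → ℤ) :
    expMonomial k (fun i => x i + (l i : ℝ)) = expMonomial k x := by
  unfold expMonomial
  congr 1
  funext i
  simp

lemma norm_expMonomial (k : Fin d → ℤ) (x : Fin d → ℝ) : ‖expMonomial k x‖ = 1 := by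
  rw [expMonomial_eq, Complex.norm_exp]
  simp

/-- Fourier coefficients of a periodic function, as integrals over the unit cube. -/
noncomputable def cubeCoeff (F : (Fin d → ℝ) → ℝ) (k : Fin d → ℤ) : ℂ :=
  ∫ x in unitCube d, expMonomial (-k) x * F x

lemma cubeCoeff_pder {F : (Fin d → ℝ) → ℝ} (hF : ContDiff ℝ ∞ F) (hp : ZPer F) (i : Fin d)
    (k : Fin d → ℤ) : cubeCoeff (pder i F) k = 2 * π * Complex.I * k i * cubeCoeff F k := by
  have hFc : ContDiff ℝ ∞ fun x => (F x : ℂ) := Complex.ofRealCLM.contDiff.comp hF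
  have hE := contDiff_expMonomial (-k)
  have hFd : ∀ x, fderiv ℝ (fun x => (F x : ℂ)) x (Pi.single i 1) = pder i F x := fun x => by
    have h := (hF.differentiable (by simp) x).hasFDerivAt
    have h' : HasFDerivAt (fun x => (F x : ℂ)) _ x := Complex.ofRealCLM.hasFDerivAt.comp x h
    rw [h'.fderiv, pder_eq_fderiv (hF.differentiable (by simp) x)]
    rfl
  have h0 := integral_fderiv_single_eq_zero (G := fun x => expMonomial (-k) x * F x)
    ((hE.mul hFc).of_le (by simp)) (fun x l => by
      rw [expMonomial_periodic, hp x l]) i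
  have hd : ∀ x, fderiv ℝ (fun x => expMonomial (-k) x * F x) x (Pi.single i 1)
      = expMonomial (-k) x * pder i F x
        - 2 * π * Complex.I * k i * (expMonomial (-k) x * F x) := fun x => by
    rw [fderiv_fun_mul (hE.differentiable (by simp) x) (hFc.differentiable (by simp) x)]
    simp only [add_apply, smul_apply, smul_eq_mul, hFd,
      fderiv_expMonomial]
    push_cast [Pi.neg_apply]
    ring
  have hFi : Continuous fun x => (pder i F x : ℂ) :=
    Complex.continuous_ofReal.comp (hF.pder i).continuous
  simp only [hd] at h0
  rw [integral_sub, integral_const_mul, sub_eq_zero] at h0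
  · exact h0
  · exact (hE.continuous.mul hFi).continuousOn.integrableOn_compact (isCompact_unitCube d)
  · exact (continuous_const.mul (hE.continuous.mul hFc.continuous)).continuousOn.integrableOn_compact
      (isCompact_unitCube d)

lemma cubeCoeff_pder_iterate {F : (Fin d → ℝ) → ℝ} (hF : ContDiff ℝ ∞ F) (hp : ZPer F)
    (i : Fin d) (n : ℕ) (k : Fin d → ℤ) :
    cubeCoeff ((pder i)^[n] F) k = (2 * π * Complex.I * k i) ^ n * cubeCoeff F k := by
  induction n with
  | zero => simp
  | succ n ih =>
    rw [Function.iterate_succ_apply', cubeCoeff_pder (hF.pder_iterate i n) (hp.pder_iterate hF i n),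
      ih]
    ring

lemma setIntegral_Ioc_eq_unitCube {E : Type*} [NormedAddCommGroup E] [NormedSpace ℝ E]
    (f : (Fin d → ℝ) → E) :
    ∫ x in {x : Fin d → ℝ | ∀ i, x i ∈ Set.Ioc ((0 : Fin d → ℝ) i) ((0 : Fin d → ℝ) i + 1)}, f x
      = ∫ x in unitCube d, f x := by
  refine setIntegral_congr_set ?_
  have h := Measure.univ_pi_Ioc_ae_eq_Icc (μ := fun _ : Fin d => (volume : Measure ℝ))
    (f := 0) (g := 1)
  have h' : {x : Fin d → ℝ | ∀ i, x i ∈ Set.Ioc ((0 : Fin d → ℝ) i) ((0 : Fin d → ℝ) i + 1)}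
      = Set.univ.pi fun i => Set.Ioc ((0 : Fin d → ℝ) i) ((1 : Fin d → ℝ) i) := by
    ext x
    simp
  rw [h']
  exact h

/-- The continuous function on the torus induced by a continuous periodic function. -/
lemma exists_torus_lift {F : (Fin d → ℝ) → ℝ} (hF : Continuous F) (hp : ZPer F) :
    ∃ g : C(UnitAddTorus (Fin d), ℂ), ∀ x : Fin d → ℝ, g (fun i => (x i : UnitAddCircle)) = F x := by
  have hq : IsOpenQuotientMap
      (Pi.map fun (_ : Fin d) (s : ℝ) => (s : UnitAddCircle)) :=
    IsOpenQuotientMap.piMap fun _ => QuotientAddGroup.isOpenQuotientMap_mk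
  let g : UnitAddTorus (Fin d) → ℂ := fun y => F (Function.surjInv hq.surjective y)
  have hg : ∀ x : Fin d → ℝ, g (fun i => (x i : UnitAddCircle)) = F x := fun x => by
    have h := Function.surjInv_eq hq.surjective (fun i => (x i : UnitAddCircle))
    set z := Function.surjInv hq.surjective (fun i => (x i : UnitAddCircle)) with hz
    have h' : ∀ i, ∃ n : ℤ, z i = x i + n := fun i => by
      have hi : (z i : UnitAddCircle) = x i := congrFun h i
      rw [← sub_eq_zero, ← AddCircle.coe_sub, AddCircle.coe_eq_zero_iff] at hi
      obtain ⟨n, hn⟩ := hi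
      exact ⟨n, by simp at hn; linarith⟩
    choose n hn using h'
    have : g (fun i => (x i : UnitAddCircle)) = F z := rfl
    rw [this, ← hp x n]
    congr 2
    exact funext hn
  refine ⟨⟨g, hq.isQuotientMap.continuous_iff.2 ?_⟩, hg⟩
  have : g ∘ (Pi.map fun (_ : Fin d) (s : ℝ) => (s : UnitAddCircle)) = fun x => (F x : ℂ) :=
    funext hg
  rw [this]
  exact Complex.continuous_ofReal.comp hF

lemma mFourierCoeff_eq_cubeCoeff {F : (Fin d → ℝ) → ℝ} {g : C(UnitAddTorus (Fin d), ℂ)}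
    (hg : ∀ x : Fin d → ℝ, g (fun i => (x i : UnitAddCircle)) = F x) (k : Fin d → ℤ) :
    mFourierCoeff g k = cubeCoeff F k := by
  rw [mFourierCoeff_eq_integral g k 0, setIntegral_Ioc_eq_unitCube, cubeCoeff]
  simp only [hg, expMonomial, smul_eq_mul]

lemma hasSum_sq_cubeCoeff {F : (Fin d → ℝ) → ℝ} (hF : Continuous F) (hp : ZPer F) :
    HasSum (fun k => ‖cubeCoeff F k‖ ^ 2) (∫ x in unitCube d, F x ^ 2) := by
  obtain ⟨g, hg⟩ := exists_torus_lift hF hp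
  have h := hasSum_sq_mFourierCoeff (ContinuousMap.toLp 2 volume ℂ g)
  simp only [mFourierCoeff_toLp, mFourierCoeff_eq_cubeCoeff hg] at h
  convert h using 1
  have hae : ∀ᵐ t, ‖ContinuousMap.toLp 2 volume ℂ g t‖ ^ 2 = ‖g t‖ ^ 2 := by
    filter_upwards [ContinuousMap.coeFn_toLp (p := 2) (𝕜 := ℂ) volume g] with t ht
    rw [ht]
  rw [integral_congr_ae hae, UnitAddTorus.integral_preimage _ 0, setIntegral_Ioc_eq_unitCube]
  simp [hg]

lemma norm_le_tsum_cubeCoeff {F : (Fin d → ℝ) → ℝ} (hF : Continuous F) (hp : ZPer F)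
    (hs : Summable fun k => ‖cubeCoeff F k‖) (x : Fin d → ℝ) :
    |F x| ≤ ∑' k, ‖cubeCoeff F k‖ := by
  obtain ⟨g, hg⟩ := exists_torus_lift hF hp
  have hs' : Summable (mFourierCoeff g) := by
    refine Summable.of_norm ?_
    simpa only [mFourierCoeff_eq_cubeCoeff hg] using hs
  have h := hasSum_mFourier_series_apply_of_summable hs' fun i => (x i : UnitAddCircle)
  rw [hg] at h
  have hn : ∀ k : Fin d → ℤ,
      ‖mFourierCoeff g k • mFourier k (fun i => (x i : UnitAddCircle))‖ = ‖cubeCoeff F k‖ :=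
    fun k => by
      rw [norm_smul, mFourierCoeff_eq_cubeCoeff hg]
      exact (congrArg _ (norm_expMonomial k x)).trans (mul_one _)
  have h2 := norm_tsum_le_tsum_norm (f := fun k => mFourierCoeff g k •
    mFourier k (fun i => (x i : UnitAddCircle))) (by simpa only [hn] using hs)
  rw [h.tsum_eq] at h2
  simpa only [hn, Complex.norm_real, Real.norm_eq_abs] using h2

end Fourier

section Sobolev

variable {d : ℕ}

lemma summable_norm_inv_pow_int {n : ℕ} (hn : d < n) :
    Summable fun k : Fin d → ℤ => ‖k‖⁻¹ ^ n := by
  let L : Submodule ℤ (Fin d → ℝ) := Submodule.span ℤ (Set.range (Pi.basisFun ℝ (Fin d)))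
  have hmem : ∀ k : Fin d → ℤ, (fun i => (k i : ℝ)) ∈ L := fun k => by
    rw [Module.Basis.mem_span_iff_repr_mem]
    exact fun i => ⟨k i, by simp⟩
  have hrank : Module.finrank ℤ L = d := by
    rw [ZLattice.rank ℝ L]
    simp
  have h := ZLattice.summable_norm_pow_inv L n (by rwa [hrank])
  have hinj : Function.Injective fun k : Fin d → ℤ => (⟨fun i => (k i : ℝ), hmem k⟩ : L) := by
    intro k l hkl
    funext i
    have := congrFun (congrArg Subtype.val hkl) i
    simpa using this
  refine (h.comp_injective hinj).congr fun k => ?_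
  have : ‖(fun i => (k i : ℝ))‖ = ‖k‖ := by
    simp only [Pi.norm_def]
    rfl
  simp only [Function.comp, Submodule.coe_norm, this]

lemma summable_inv_one_add_sum_pow {n : ℕ} (hn : d < 2 * n) :
    Summable fun k : Fin d → ℤ => (1 + ∑ i, |(k i : ℝ)| ^ (2 * n))⁻¹ := by
  rw [← (Set.finite_singleton (0 : Fin d → ℤ)).summable_compl_iff]
  refine Summable.of_nonneg_of_le (fun k => ?_) (fun k => ?_)
    ((summable_norm_inv_pow_int hn).comp_injective Subtype.val_injective)
  · simp only [Function.comp]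
    positivity
  have hk : (k : Fin d → ℤ) ≠ 0 := k.2
  have hd : Nonempty (Fin d) := by
    by_contra h
    rw [not_nonempty_iff] at h
    exact hk (Subsingleton.elim _ _)
  obtain ⟨i, hi⟩ : ∃ i, ‖(k : Fin d → ℤ)‖ = ‖(k : Fin d → ℤ) i‖ := by
    obtain ⟨i, -, hi⟩ := Finset.exists_max_image Finset.univ
      (fun i => ‖(k : Fin d → ℤ) i‖) Finset.univ_nonempty
    exact ⟨i, le_antisymm ((pi_norm_le_iff_of_nonneg (norm_nonneg _)).2
      fun j => hi j (Finset.mem_univ j)) (norm_le_pi_norm _ i)⟩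
  have hpos : 0 < ‖(k : Fin d → ℤ)‖ := norm_pos_iff.2 hk
  simp only [Function.comp, inv_pow]
  refine inv_anti₀ (by positivity) ?_
  rw [hi, Int.norm_eq_abs]
  have := Finset.single_le_sum (f := fun i => |((k : Fin d → ℤ) i : ℝ)| ^ (2 * n))
    (fun i _ => by positivity) (Finset.mem_univ i)
  linarith

/-- The Sobolev embedding `H^n(𝕋^d) ⊂ L^∞(𝕋^d)` for `2n > d`. -/
lemma exists_abs_le_of_integral_sq_pder_le {n : ℕ} (hn : d < 2 * n) (B : ℝ) :
    ∃ M, ∀ F : (Fin d → ℝ) → ℝ, ContDiff ℝ ∞ F → ZPer F → (∫ x in unitCube d, F x ^ 2) ≤ B →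
      (∀ i, ∫ x in unitCube d, ((pder i)^[n] F x) ^ 2 ≤ B) → ∀ x, |F x| ≤ M := by
  set a : (Fin d → ℤ) → ℝ := fun k => 1 + ∑ i, |(k i : ℝ)| ^ (2 * n) with ha
  have hsa : Summable fun k => (a k)⁻¹ := summable_inv_one_add_sum_pow hn
  refine ⟨∑' k, (a k)⁻¹ + (B + ∑ _i : Fin d, B), fun F hF hp h0 hB x => ?_⟩
  have hapos : ∀ k, 0 < a k := fun k => by positivity
  set c : (Fin d → ℤ) → ℝ := fun k => ‖cubeCoeff F k‖ with hc
  have hs0 : HasSum (fun k => c k ^ 2) _ := hasSum_sq_cubeCoeff hF.continuous hp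
  have hsi : ∀ i, HasSum (fun k : Fin d → ℤ => ‖(2 * π * Complex.I * k i) ^ n * cubeCoeff F k‖ ^ 2)
      (∫ x in unitCube d, ((pder i)^[n] F x) ^ 2) := fun i => by
    simpa only [cubeCoeff_pder_iterate hF hp] using
      hasSum_sq_cubeCoeff (hF.pder_iterate i n).continuous (hp.pder_iterate hF i n)
  have hsum := hs0.add (hasSum_sum (s := Finset.univ) fun i _ => hsi i)
  have hterm : ∀ k, a k * c k ^ 2 ≤ c k ^ 2
      + ∑ i, ‖(2 * π * Complex.I * k i) ^ n * cubeCoeff F k‖ ^ 2 := fun k => by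
    rw [ha]
    dsimp only
    rw [add_mul, one_mul, Finset.sum_mul]
    gcongr with i
    rw [norm_mul, norm_pow, mul_pow, ← pow_mul, mul_comm n 2]
    simp only [norm_mul, Complex.norm_I, Complex.norm_real, Complex.norm_ofNat, mul_one,
      Complex.norm_intCast, Real.norm_eq_abs, abs_of_pos Real.pi_pos]
    gcongr
    nlinarith [Real.pi_gt_three, abs_nonneg (k i : ℝ)]
  have hac : Summable fun k => a k * c k ^ 2 :=
    Summable.of_nonneg_of_le (fun k => mul_nonneg (hapos k).le (sq_nonneg _)) hterm hsum.summable
  have hac' : ∑' k, a k * c k ^ 2 ≤ B + ∑ _i : Fin d, B := by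
    refine (hac.tsum_le_tsum hterm hsum.summable).trans ?_
    rw [hsum.tsum_eq]
    gcongr with i
    exact hB i
  have hle : ∀ k, c k ≤ (a k)⁻¹ + a k * c k ^ 2 := fun k => by
    have h1 := hapos k
    have h2 : (a k)⁻¹ * a k = 1 := inv_mul_cancel₀ h1.ne'
    have h3 : 0 < (a k)⁻¹ := inv_pos.2 h1
    have h4 : (a k)⁻¹ + a k * c k ^ 2 - c k
        = (a k)⁻¹ * ((a k * c k - 1 / 2) ^ 2 + 3 / 4) := by
      field_simp
      ring
    have h5 : 0 ≤ (a k)⁻¹ * ((a k * c k - 1 / 2) ^ 2 + 3 / 4) := by positivity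
    linarith
  have hcs : Summable c := Summable.of_nonneg_of_le (fun k => norm_nonneg _) hle (hsa.add hac)
  calc |F x| ≤ ∑' k, c k := norm_le_tsum_cubeCoeff hF.continuous hp hcs x
    _ ≤ ∑' k, ((a k)⁻¹ + a k * c k ^ 2) := hcs.tsum_le_tsum hle (hsa.add hac)
    _ = ∑' k, (a k)⁻¹ + ∑' k, a k * c k ^ 2 := hsa.tsum_add hac
    _ ≤ _ := by gcongr

lemma integral_sq_mder_le {β : ℕ} {R : ℝ} {F : (Fin d → ℝ) → ℝ} (h : hSob β F ≤ R)
    (j : Fin d → ℕ) (hj : ∑ i, j i ≤ β) :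
    ∫ x in unitCube d, (mder j F x) ^ 2 ≤ R ^ 2 := by
  have hle : hSobSq β F ≤ R ^ 2 := (Real.sqrt_le_left ((Real.sqrt_nonneg _).trans h)).1 h
  have hlt : ∀ i, j i < β + 1 := fun i =>
    Nat.lt_succ_of_le ((Finset.single_le_sum (fun _ _ => Nat.zero_le _) (Finset.mem_univ i)).trans hj)
  refine le_trans ?_ hle
  exact Finset.single_le_sum
    (f := fun j : Fin d → Fin (β + 1) => ∫ x in unitCube d, (mder (fun i => (j i : ℕ)) F x) ^ 2)
    (fun j _ => integral_nonneg fun x => sq_nonneg _)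
    (Finset.mem_filter.2 ⟨Finset.mem_univ (fun i => (⟨j i, hlt i⟩ : Fin (β + 1))), hj⟩)

lemma exists_abs_le_of_hSob_le {β : ℕ} (hβ : d < 2 * β) (R : ℝ) :
    ∃ M, ∀ F : (Fin d → ℝ) → ℝ, ContDiff ℝ ∞ F → ZPer F → hSob β F ≤ R → ∀ x, |F x| ≤ M := by
  obtain ⟨M, hM⟩ := exists_abs_le_of_integral_sq_pder_le hβ (R ^ 2)
  refine ⟨M, fun F hF hp h => hM F hF hp ?_ fun i => ?_⟩
  · simpa only [mder_zero] using integral_sq_mder_le h 0 (by simp)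
  · simpa only [mder_single] using integral_sq_mder_le h (Pi.single i β) (by simp)

end Sobolev

section Parabolic

variable {d : ℕ}

/-- Lebesgue measure on `𝕋^d × (0,T)`, as a product measure. -/
noncomputable def cylMeasure (d : ℕ) (T : ℝ) : Measure ((Fin d → ℝ) × ℝ) :=
  (volume.restrict (unitCube d)).prod (volume.restrict (Set.Ioc 0 T))

lemma integrable_cylMeasure {g : (Fin d → ℝ) × ℝ → ℝ} (hg : Continuous g) (T : ℝ) :
    Integrable g (cylMeasure d T) := by
  have h : IntegrableOn g (unitCube d ×ˢ Set.Icc 0 T) (volume.prod volume) :=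
    hg.continuousOn.integrableOn_compact ((isCompact_unitCube d).prod isCompact_Icc)
  rw [cylMeasure, Measure.prod_restrict]
  exact h.mono_set (Set.prod_mono_right Set.Ioc_subset_Icc_self)

/-- The density whose integral over `𝕋^d × (0,T)` is the squared `H^{2,1}`-norm. -/
noncomputable def h21Density (u : (Fin d → ℝ) → ℝ → ℝ) (p : (Fin d → ℝ) × ℝ) : ℝ :=
  (∑ j ∈ Finset.univ.filter (fun j : Fin d → Fin 3 => (∑ i, (j i : ℕ)) ≤ 2),
      (mder (fun i => (j i : ℕ)) (fun y => u y p.2) p.1) ^ 2)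
    + ((u p.1 p.2) ^ 2 + (deriv (u p.1) p.2) ^ 2)

lemma continuous_h21Density {u : (Fin d → ℝ) → ℝ → ℝ} (hu : SmoothQ u) :
    Continuous (h21Density u) :=
  (continuous_finsetSum _ fun _ _ => (ContDiff.continuous (hu.mder _)).pow 2).add
    (((ContDiff.continuous hu).pow 2).add ((ContDiff.continuous hu.deriv_time).pow 2))

lemma h21Density_nonneg (u : (Fin d → ℝ) → ℝ → ℝ) (p : (Fin d → ℝ) × ℝ) :
    0 ≤ h21Density u p := by
  unfold h21Density
  positivity

lemma integral_h21Density {u : (Fin d → ℝ) → ℝ → ℝ} (hu : SmoothQ u) (T : ℝ) :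
    ∫ p, h21Density u p ∂cylMeasure d T = h21Sq T u := by
  have h1 : ∀ j : Fin d → ℕ,
      Continuous fun p : (Fin d → ℝ) × ℝ => (mder j (fun y => u y p.2) p.1) ^ 2 :=
    fun j => (ContDiff.continuous (hu.mder j)).pow 2
  have h2 : Continuous fun p : (Fin d → ℝ) × ℝ => (u p.1 p.2) ^ 2 + (deriv (u p.1) p.2) ^ 2 :=
    ((ContDiff.continuous hu).pow 2).add ((ContDiff.continuous hu.deriv_time).pow 2)
  have h3 : Continuous fun p : (Fin d → ℝ) × ℝ =>
      ∑ j ∈ Finset.univ.filter (fun j : Fin d → Fin 3 => (∑ i, (j i : ℕ)) ≤ 2),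
        (mder (fun i => (j i : ℕ)) (fun y => u y p.2) p.1) ^ 2 :=
    continuous_finsetSum _ fun _ _ => h1 _
  unfold h21Density h21Sq
  rw [integral_add (integrable_cylMeasure h3 T) (integrable_cylMeasure h2 T)]
  congr 1
  · rw [cylMeasure, integral_prod_symm _ (integrable_cylMeasure h3 T)]
    refine integral_congr_ae (.of_forall fun t => ?_)
    refine integral_finsetSum _ fun j _ => ?_
    exact ((h1 fun i => (j i : ℕ)).comp
      (continuous_id.prodMk continuous_const)).continuousOn.integrableOn_compact
      (isCompact_unitCube d)
  · rw [cylMeasure, integral_prod _ (integrable_cylMeasure h2 T)]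

lemma sq_mder_le_h21Density (u : (Fin d → ℝ) → ℝ → ℝ) (p : (Fin d → ℝ) × ℝ) (i : Fin d) :
    (pder i (pder i fun y => u y p.2) p.1) ^ 2 ≤ h21Density u p := by
  have hle : ∀ l, (Pi.single i 2 : Fin d → ℕ) l < 3 := fun l => by
    by_cases h : l = i
    · subst h; simp
    · simp [h]
  have h := Finset.single_le_sum
    (s := Finset.univ.filter fun j : Fin d → Fin 3 => (∑ i, (j i : ℕ)) ≤ 2)
    (f := fun j : Fin d → Fin 3 => (mder (fun i => (j i : ℕ)) (fun y => u y p.2) p.1) ^ 2)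
    (fun j _ => sq_nonneg _)
    (Finset.mem_filter.2 ⟨Finset.mem_univ (fun l => (⟨(Pi.single i 2 : Fin d → ℕ) l, hle l⟩ : Fin 3)),
      show ∑ l, (Pi.single i 2 : Fin d → ℕ) l ≤ 2 by simp⟩)
  have hm : mder (Pi.single i 2) (fun y => u y p.2) = pder i (pder i fun y => u y p.2) :=
    mder_single i 2 _
  rw [← hm]
  exact h.trans (le_add_of_nonneg_right (by positivity))

lemma tendsto_zero_of_sq_le {a b : ℕ → ℝ} (hb : Tendsto b atTop (𝓝 0))
    (h : ∀ m, a m ^ 2 ≤ b m) : Tendsto a atTop (𝓝 0) := by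
  have h2 : Tendsto (fun m => a m ^ 2) atTop (𝓝 0) :=
    squeeze_zero (fun m => sq_nonneg _) h hb
  have h3 := h2.sqrt
  simp only [Real.sqrt_sq_eq_abs, Real.sqrt_zero] at h3
  exact (tendsto_zero_iff_abs_tendsto_zero _).2 h3

lemma exists_subseq_tendsto_ae_of_h21 {T : ℝ} {w : ℕ → (Fin d → ℝ) → ℝ → ℝ}
    (hw : ∀ m, SmoothQ (w m)) (h : Tendsto (fun m => h21 T (w m)) atTop (𝓝 0)) :
    ∃ φ : ℕ → ℕ, StrictMono φ ∧ ∀ᵐ p ∂cylMeasure d T,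
      Tendsto (fun m => w (φ m) p.1 p.2) atTop (𝓝 0) ∧
      Tendsto (fun m => lap (fun y => w (φ m) y p.2) p.1) atTop (𝓝 0) ∧
      Tendsto (fun m => deriv (w (φ m) p.1) p.2) atTop (𝓝 0) := by
  have hint : ∀ m, Integrable (h21Density (w m)) (cylMeasure d T) := fun m =>
    integrable_cylMeasure (continuous_h21Density (hw m)) T
  have hlim : Tendsto (fun m => ∫ p, h21Density (w m) p ∂cylMeasure d T) atTop (𝓝 0) := by
    have h2 := h.pow 2
    simp only [ne_eq, OfNat.ofNat_ne_zero, not_false_eq_true, zero_pow] at h2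
    refine h2.congr fun m => ?_
    rw [integral_h21Density (hw m), h21, Real.sq_sqrt]
    rw [← integral_h21Density (hw m)]
    exact integral_nonneg (h21Density_nonneg _)
  have hL1 : Tendsto (fun m => eLpNorm (h21Density (w m) - 0) 1 (cylMeasure d T)) atTop (𝓝 0) := by
    have h2 := ENNReal.tendsto_ofReal hlim
    rw [ENNReal.ofReal_zero] at h2
    refine h2.congr fun m => ?_
    rw [sub_zero, eLpNorm_one_eq_lintegral_enorm, ← ofReal_integral_norm_eq_lintegral_enorm (hint m)]
    congr 1
    exact integral_congr_ae (.of_forall fun p =>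
      (Real.norm_of_nonneg (h21Density_nonneg (w m) p)).symm)
  obtain ⟨φ, hφ, hae⟩ := (tendstoInMeasure_of_tendsto_eLpNorm one_ne_zero
    (fun m => (hint m).aestronglyMeasurable) aestronglyMeasurable_zero hL1).exists_seq_tendsto_ae
  refine ⟨φ, hφ, hae.mono fun p hp => ⟨?_, ?_, ?_⟩⟩
  · refine tendsto_zero_of_sq_le hp fun m => ?_
    have : 0 ≤ ∑ j ∈ Finset.univ.filter (fun j : Fin d → Fin 3 => (∑ i, (j i : ℕ)) ≤ 2),
      (mder (fun i => (j i : ℕ)) (fun y => w (φ m) y p.2) p.1) ^ 2 := by positivity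
    unfold h21Density
    nlinarith [sq_nonneg (deriv (w (φ m) p.1) p.2)]
  · have h0 : (0 : ℝ) = ∑ _i : Fin d, (0 : ℝ) := by simp
    rw [h0]
    exact tendsto_finsetSum _ fun i _ =>
      tendsto_zero_of_sq_le hp fun m => sq_mder_le_h21Density (w (φ m)) p i
  · refine tendsto_zero_of_sq_le hp fun m => ?_
    have : 0 ≤ ∑ j ∈ Finset.univ.filter (fun j : Fin d → Fin 3 => (∑ i, (j i : ℕ)) ≤ 2),
      (mder (fun i => (j i : ℕ)) (fun y => w (φ m) y p.2) p.1) ^ 2 := by positivity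
    unfold h21Density
    nlinarith [sq_nonneg (w (φ m) p.1 p.2)]

lemma subset_closure_interior_unitCube (d : ℕ) : unitCube d ⊆ closure (interior (unitCube d)) := by
  have hne : (interior (unitCube d)).Nonempty := by
    refine ⟨fun _ => 1 / 2, ?_⟩
    rw [unitCube, ← Set.pi_univ_Icc, interior_pi_set Set.finite_univ]
    intro i _
    simp only [Pi.zero_apply, Pi.one_apply, interior_Icc]
    norm_num
  have h : Convex ℝ (unitCube d) := convex_Icc 0 1
  rw [h.closure_interior_eq_closure_of_nonempty_interior hne]
  exact subset_closure

lemma exists_mem_unitCube_add_int (x : Fin d → ℝ) :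
    ∃ y ∈ unitCube d, ∃ k : Fin d → ℤ, x = fun i => y i + (k i : ℝ) :=
  ⟨fun i => Int.fract (x i), ⟨fun _ => Int.fract_nonneg _, fun _ => (Int.fract_lt_one _).le⟩,
    fun i => ⌊x i⌋, funext fun i => (Int.fract_add_floor (x i)).symm⟩

lemma mem_Icc_of_ae_mem_Icc {g : (Fin d → ℝ) → ℝ} (hg : ContinuousOn g (unitCube d)) {a b : ℝ}
    (h : ∀ᵐ x ∂volume.restrict (unitCube d), g x ∈ Set.Icc a b) {x : Fin d → ℝ}
    (hx : x ∈ unitCube d) : g x ∈ Set.Icc a b := by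
  have hae : (fun x => max a (min b (g x))) =ᵐ[volume.restrict (unitCube d)] g :=
    h.mono fun y hy => by simp [hy.1, hy.2]
  have heq : max a (min b (g x)) = g x := Measure.eqOn_of_ae_eq hae
    (continuousOn_const.sup (continuousOn_const.inf hg)) hg (subset_closure_interior_unitCube d) hx
  have hab : a ≤ b := by
    have hne : volume.restrict (unitCube d) ≠ 0 := by
      rw [ne_eq, Measure.restrict_eq_zero, unitCube, Real.volume_Icc_pi]
      simp
    have := ae_neBot.2 hne
    obtain ⟨y, hy⟩ := h.exists
    exact hy.1.trans hy.2
  rw [← heq]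
  exact ⟨le_max_left _ _, max_le hab (min_le_left _ _)⟩

/-- An a.e. limit of time-independent functions that is continuous is time-independent. -/
lemma time_independent_of_tendsto_ae {T : ℝ} (hT : 0 < T) {H : (Fin d → ℝ) → ℝ → ℝ}
    (hHt : ∀ x, ContinuousOn (H x) (Set.Icc 0 T))
    (hHx : ∀ t ∈ Set.Icc 0 T, Continuous fun x => H x t) {f : ℕ → (Fin d → ℝ) → ℝ}
    (h : ∀ᵐ p ∂cylMeasure d T, Tendsto (fun m => f m p.1) atTop (𝓝 (H p.1 p.2))) :
    (∀ x ∈ unitCube d, ∀ t ∈ Set.Icc 0 T, H x t = H x 0) ∧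
      ∀ᵐ x ∂volume.restrict (unitCube d), Tendsto (fun m => f m x) atTop (𝓝 (H x 0)) := by
  have hne : volume.restrict (Set.Ioc 0 T) ≠ 0 := by
    rw [ne_eq, Measure.restrict_eq_zero, Real.volume_Ioc]
    simpa using hT
  have := ae_neBot.2 hne
  have hcl : Set.Icc 0 T ⊆ closure (interior (Set.Icc 0 T)) := by
    rw [interior_Icc, closure_Ioo hT.ne]
  have h0 : (0 : ℝ) ∈ Set.Icc 0 T := ⟨le_rfl, hT.le⟩
  have key : ∀ᵐ x ∂volume.restrict (unitCube d), (∀ t ∈ Set.Icc 0 T, H x t = H x 0) ∧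
      Tendsto (fun m => f m x) atTop (𝓝 (H x 0)) := by
    filter_upwards [Measure.ae_ae_of_ae_prod h] with x hx
    obtain ⟨s, hs⟩ := hx.exists
    have hae : H x =ᵐ[volume.restrict (Set.Icc 0 T)] fun _ => H x s := by
      rw [← restrict_Ioc_eq_restrict_Icc]
      exact hx.mono fun t ht => tendsto_nhds_unique ht hs
    have heq := Measure.eqOn_of_ae_eq hae (hHt x) continuousOn_const hcl
    exact ⟨fun t ht => (heq ht).trans (heq h0).symm, (heq h0).symm ▸ hs⟩
  refine ⟨fun x hx t ht => ?_, key.mono fun x hx => hx.2⟩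
  exact Measure.eqOn_of_ae_eq (key.mono fun y hy => hy.1 t ht) (hHx t ht).continuousOn
    (hHx 0 h0).continuousOn (subset_closure_interior_unitCube d) hx

lemma LinkFun.strictMono (Φ : LinkFun) : StrictMono Φ.toFun := strictMono_of_deriv_pos Φ.deriv_pos

lemma LinkFun.isEmbedding (Φ : LinkFun) : Topology.IsEmbedding Φ.toFun :=
  Φ.strictMono.isEmbedding_of_ordConnected
    (isPreconnected_range Φ.smooth.continuous).ordConnected

end Parabolic

section Inversion

variable {d : ℕ}

/-- The absorption that `ustar`, a solution with diffusivity `θ₀` and absorption `f₀`, would need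
to have at `(x, t)` in order to solve the equation with diffusivity `θ`. -/
noncomputable def impliedAbsorption (θ θ₀ : ℝ) (f₀ : (Fin d → ℝ) → ℝ)
    (ustar : (Fin d → ℝ) → ℝ → ℝ) (x : Fin d → ℝ) (t : ℝ) : ℝ :=
  f₀ x + (θ - θ₀) / 2 * lap (fun y => ustar y t) x / ustar x t

lemma HeatSol.tendsto_absorption {T θ θ₀ : ℝ} {f₀ u0 : (Fin d → ℝ) → ℝ}
    {ustar : (Fin d → ℝ) → ℝ → ℝ} (hustar : HeatSol T θ₀ f₀ u0 ustar)
    {θm : ℕ → ℝ} {fm : ℕ → (Fin d → ℝ) → ℝ} {um : ℕ → (Fin d → ℝ) → ℝ → ℝ}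
    (hum : ∀ m, HeatSol T (θm m) (fm m) u0 (um m)) (hθ : Tendsto θm atTop (𝓝 θ))
    {x : Fin d → ℝ} {t : ℝ} (ht : t ∈ Set.Ioc 0 T) (hne : ustar x t ≠ 0)
    (h0 : Tendsto (fun m => um m x t - ustar x t) atTop (𝓝 0))
    (h1 : Tendsto (fun m => lap (fun y => um m y t - ustar y t) x) atTop (𝓝 0))
    (h2 : Tendsto (fun m => deriv (fun s => um m x s - ustar x s) t) atTop (𝓝 0)) :
    Tendsto (fun m => fm m x) atTop (𝓝 (impliedAbsorption θ θ₀ f₀ ustar x t)) := by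
  have e0 : Tendsto (fun m => um m x t) atTop (𝓝 (ustar x t)) := by
    simpa using h0.add_const (ustar x t)
  have e1 : Tendsto (fun m => lap (fun y => um m y t) x) atTop
      (𝓝 (lap (fun y => ustar y t) x)) := by
    have h := h1.add_const (lap (fun y => ustar y t) x)
    rw [zero_add] at h
    refine h.congr fun m => ?_
    rw [lap_sub ((hum m).1.contDiff_space t) (hustar.1.contDiff_space t), sub_add_cancel]
  have e2 : Tendsto (fun m => deriv (um m x) t) atTop (𝓝 (deriv (ustar x) t)) := by
    have h := h2.add_const (deriv (ustar x) t)
    rw [zero_add] at h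
    refine h.congr fun m => ?_
    rw [deriv_fun_sub (((hum m).1.contDiff_time x).differentiable (by simp) t)
      ((hustar.1.contDiff_time x).differentiable (by simp) t), sub_add_cancel]
  have h := (((hθ.div_const 2).mul e1).sub e2).div e0 hne
  have hlim : (θ / 2 * lap (fun y => ustar y t) x - deriv (ustar x) t) / ustar x t =
      impliedAbsorption θ θ₀ f₀ ustar x t := by
    rw [hustar.2.2.1 x t ht, impliedAbsorption]
    field_simp
    ring
  rw [hlim] at h
  refine h.congr' ?_
  filter_upwards [e0.eventually_ne hne] with m hm
  simp only [Pi.div_apply]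
  rw [(hum m).2.2.1 x t ht]
  field_simp
  ring

/-- A continuous `h` taking values in the range of a link function factors through it. -/
lemma LinkFun.exists_factor (Φ : LinkFun) {h : (Fin d → ℝ) → ℝ} (hc : Continuous h) (hp : ZPer h)
    (hr : ∀ x, h x ∈ Set.range Φ.toFun) :
    ∃ F : (Fin d → ℝ) → ℝ, Continuous F ∧ ZPer F ∧ ∀ x, Φ.toFun (F x) = h x := by
  choose F hF using hr
  refine ⟨F, ?_, fun x k => ?_, hF⟩
  · rw [Φ.isEmbedding.continuous_iff]
    exact hc.congr fun x => (hF x).symm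
  · exact Φ.strictMono.injective (by rw [hF, hF, hp])

lemma tendsto_l2T_zero_of_tendsto_ae {F₀ : (Fin d → ℝ) → ℝ} {Fm : ℕ → (Fin d → ℝ) → ℝ}
    (hF₀ : Continuous F₀) (hFm : ∀ m, Continuous (Fm m)) {M : ℝ} (hM : ∀ m x, |Fm m x| ≤ M)
    (h : ∀ᵐ x ∂volume.restrict (unitCube d), Tendsto (fun m => Fm m x) atTop (𝓝 (F₀ x))) :
    Tendsto (fun m => l2T fun x => Fm m x - F₀ x) atTop (𝓝 0) := by
  have hlim : Tendsto (fun m => ∫ x in unitCube d, (Fm m x - F₀ x) ^ 2) atTop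
      (𝓝 (∫ _x in unitCube d, (0 : ℝ))) := by
    refine tendsto_integral_of_dominated_convergence (fun x => (M + |F₀ x|) ^ 2)
      (fun m => (((hFm m).sub hF₀).pow 2).aestronglyMeasurable)
      (((continuous_const.add hF₀.abs).pow 2).continuousOn.integrableOn_compact
        (isCompact_unitCube d)) (fun m => .of_forall fun x => ?_) (h.mono fun x hx => ?_)
    · rw [Real.norm_eq_abs, abs_pow]
      gcongr
      exact (abs_sub _ _).trans (by gcongr; exact hM m x)
    · simpa using (hx.sub_const (F₀ x)).pow 2
  simpa [l2T] using hlim.sqrt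

/-- The inversion lemma along a sequence whose diffusivities converge and whose solutions
converge pointwise almost everywhere, together with the derivatives in the equation. -/
lemma inversion_of_tendsto_ae {T θmin θmax : ℝ} (hT : 0 < T) (Φ : LinkFun) {β : ℕ}
    (hβ : d < 2 * β) {R : ℝ} {u0 : (Fin d → ℝ) → ℝ} {θ₀ : ℝ}
    {F₀ : (Fin d → ℝ) → ℝ} (hF₀ : ContDiff ℝ ∞ F₀) (hF₀per : ZPer F₀)
    {ustar : (Fin d → ℝ) → ℝ → ℝ} (hustar : HeatSol T θ₀ (fun x => Φ.toFun (F₀ x)) u0 ustar)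
    (hpos : ∃ c > (0 : ℝ), ∀ (x : Fin d → ℝ), ∀ t ∈ Set.Icc (0 : ℝ) T, c ≤ ustar x t)
    (hinj : ∀ θ ∈ Set.Icc θmin θmax, ∀ F : (Fin d → ℝ) → ℝ, Continuous F → ZPer F →
      ∀ u : (Fin d → ℝ) → ℝ → ℝ, HeatSol T θ (fun x => Φ.toFun (F x)) u0 u →
      (∀ (x : Fin d → ℝ), ∀ t ∈ Set.Icc (0 : ℝ) T, u x t = ustar x t) →
      θ = θ₀ ∧ ∀ x, F x = F₀ x)
    {θm : ℕ → ℝ} {θ : ℝ} (hθmem : θ ∈ Set.Icc θmin θmax) (hθ : Tendsto θm atTop (𝓝 θ))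
    {Fm : ℕ → (Fin d → ℝ) → ℝ}
    (hFm : ∀ m, ContDiff ℝ ∞ (Fm m) ∧ ZPer (Fm m) ∧ hSob β (Fm m) ≤ R)
    {um : ℕ → (Fin d → ℝ) → ℝ → ℝ}
    (hum : ∀ m, HeatSol T (θm m) (fun x => Φ.toFun (Fm m x)) u0 (um m))
    (hconv : ∀ᵐ p ∂cylMeasure d T,
      Tendsto (fun m => um m p.1 p.2 - ustar p.1 p.2) atTop (𝓝 0) ∧
      Tendsto (fun m => lap (fun y => um m y p.2 - ustar y p.2) p.1) atTop (𝓝 0) ∧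
      Tendsto (fun m => deriv (fun s => um m p.1 s - ustar p.1 s) p.2) atTop (𝓝 0)) :
    Tendsto θm atTop (𝓝 θ₀) ∧ Tendsto (fun m => l2T fun x => Fm m x - F₀ x) atTop (𝓝 0) := by
  obtain ⟨c, hc, hcle⟩ := hpos
  have hne : ∀ x, ∀ t ∈ Set.Icc 0 T, ustar x t ≠ 0 := fun x t ht =>
    (hc.trans_le (hcle x t ht)).ne'
  have h0 : (0 : ℝ) ∈ Set.Icc 0 T := ⟨le_rfl, hT.le⟩
  set H := impliedAbsorption θ θ₀ (fun x => Φ.toFun (F₀ x)) ustar with hH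
  have hlapc : Continuous fun p : (Fin d → ℝ) × ℝ => lap (fun y => ustar y p.2) p.1 :=
    ContDiff.continuous hustar.1.lap
  have huc : Continuous fun p : (Fin d → ℝ) × ℝ => ustar p.1 p.2 := ContDiff.continuous hustar.1
  have hHt : ∀ x, ContinuousOn (H x) (Set.Icc 0 T) := fun x =>
    continuousOn_const.add (ContinuousOn.div
      (continuous_const.mul (hlapc.comp (Continuous.prodMk_right x))).continuousOn
      (huc.comp (Continuous.prodMk_right x)).continuousOn (hne x))
  have hHx : ∀ t ∈ Set.Icc 0 T, Continuous fun x => H x t := fun t ht =>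
    (Φ.smooth.continuous.comp hF₀.continuous).add (Continuous.div
      (continuous_const.mul (hlapc.comp (Continuous.prodMk_left t)))
      (huc.comp (Continuous.prodMk_left t)) fun x => hne x t ht)
  have hHper : ∀ t, ZPer fun x => H x t := fun t x k => by
    have h1 := (hustar.2.1 t).lap (hustar.1.contDiff_space t) x k
    have h2 := hustar.2.1 t x k
    simp only [hH, impliedAbsorption] at h1 h2 ⊢
    rw [h1, h2, hF₀per x k]
  have hae : ∀ᵐ p ∂cylMeasure d T,
      Tendsto (fun m => Φ.toFun (Fm m p.1)) atTop (𝓝 (H p.1 p.2)) := by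
    have hmem : ∀ᵐ p ∂cylMeasure d T, p ∈ unitCube d ×ˢ Set.Ioc 0 T := by
      rw [cylMeasure, Measure.prod_restrict]
      exact ae_restrict_mem (measurableSet_Icc.prod measurableSet_Ioc)
    filter_upwards [hmem, hconv] with p hp hq
    exact hustar.tendsto_absorption hum hθ hp.2 (hne _ _ (Set.Ioc_subset_Icc_self hp.2))
      hq.1 hq.2.1 hq.2.2
  obtain ⟨hHcube, hΦae⟩ := time_independent_of_tendsto_ae hT hHt hHx
    (f := fun m x => Φ.toFun (Fm m x)) hae
  obtain ⟨M, hM⟩ := exists_abs_le_of_hSob_le hβ R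
  have hFmM : ∀ m x, |Fm m x| ≤ M := fun m => hM (Fm m) (hFm m).1 (hFm m).2.1 (hFm m).2.2
  have hHindep : ∀ x, ∀ t ∈ Set.Icc 0 T, H x t = H x 0 := fun x t ht => by
    obtain ⟨y, hy, k, rfl⟩ := exists_mem_unitCube_add_int x
    exact (hHper t y k).trans ((hHcube y hy t ht).trans (hHper 0 y k).symm)
  have hrange : ∀ x, H x 0 ∈ Set.range Φ.toFun := fun x => by
    obtain ⟨y, hy, k, rfl⟩ := exists_mem_unitCube_add_int x
    rw [show H (fun i => y i + (k i : ℝ)) 0 = H y 0 from hHper 0 y k]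
    refine (isPreconnected_range Φ.smooth.continuous).ordConnected.out ⟨-M, rfl⟩ ⟨M, rfl⟩
      (mem_Icc_of_ae_mem_Icc (g := fun x => H x 0) (hHx 0 h0).continuousOn
        (hΦae.mono fun z hz => ?_) hy)
    exact isClosed_Icc.mem_of_tendsto hz (.of_forall fun m =>
      ⟨Φ.strictMono.monotone (neg_le_of_abs_le (hFmM m z)),
        Φ.strictMono.monotone (le_of_abs_le (hFmM m z))⟩)
  obtain ⟨F, hFc, hFper, hFH⟩ := Φ.exists_factor (hHx 0 h0) (hHper 0) hrange
  have hsol : HeatSol T θ (fun x => Φ.toFun (F x)) u0 ustar := by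
    refine ⟨hustar.1, hustar.2.1, fun x t ht => ?_, hustar.2.2.2⟩
    have ht' := Set.Ioc_subset_Icc_self ht
    have hne' := hne x t ht'
    simp only [hFH]
    rw [← hHindep x t ht', hustar.2.2.1 x t ht, hH, impliedAbsorption]
    field_simp
    ring
  obtain ⟨rfl, hFF⟩ := hinj θ hθmem F hFc hFper ustar hsol fun _ _ _ => rfl
  refine ⟨hθ, tendsto_l2T_zero_of_tendsto_ae hF₀.continuous (fun m => (hFm m).1.continuous) hFmM
    (hΦae.mono fun x hx => ?_)⟩
  rw [← hFH x, hFF x] at hx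
  exact Φ.isEmbedding.tendsto_nhds_iff.2 hx

end Inversion

/-- the inversion lemma used to globalize the stability estimate. -/
theorem inversion_lemma {d : ℕ} (hd : 1 ≤ d) (T θmin θmax : ℝ)
    (hT : 0 < T) (hθmin : 0 < θmin) (hθ : θmin ≤ θmax) (Φ : LinkFun)
    (β : ℕ) (hβ : 2 + (d : ℝ) / 2 < (β : ℝ)) (R : ℝ) (hR : 0 < R)
    (u0 : (Fin d → ℝ) → ℝ) (hu0 : ContDiff ℝ (⊤ : ℕ∞) u0) (hu0per : ZPer u0)
    (θ₀ : ℝ) (hθ₀ : θ₀ ∈ Set.Icc θmin θmax)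
    (F₀ : (Fin d → ℝ) → ℝ) (hF₀ : ContDiff ℝ (⊤ : ℕ∞) F₀) (hF₀per : ZPer F₀)
    (ustar : (Fin d → ℝ) → ℝ → ℝ)
    (hustar : HeatSol T θ₀ (fun x => Φ.toFun (F₀ x)) u0 ustar)
    (hpos : ∃ c > (0 : ℝ), ∀ (x : Fin d → ℝ), ∀ t ∈ Set.Icc (0 : ℝ) T, c ≤ ustar x t)
    (hinj : ∀ θ ∈ Set.Icc θmin θmax, ∀ F : (Fin d → ℝ) → ℝ, Continuous F → ZPer F →
      ∀ u : (Fin d → ℝ) → ℝ → ℝ, HeatSol T θ (fun x => Φ.toFun (F x)) u0 u →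
      (∀ (x : Fin d → ℝ), ∀ t ∈ Set.Icc (0 : ℝ) T, u x t = ustar x t) →
      θ = θ₀ ∧ ∀ x, F x = F₀ x)
    (θm : ℕ → ℝ) (hθm : ∀ m, θm m ∈ Set.Icc θmin θmax)
    (Fm : ℕ → (Fin d → ℝ) → ℝ)
    (hFm : ∀ m, ContDiff ℝ (⊤ : ℕ∞) (Fm m) ∧ ZPer (Fm m) ∧ hSob β (Fm m) ≤ R)
    (um : ℕ → (Fin d → ℝ) → ℝ → ℝ)
    (hum : ∀ m, HeatSol T (θm m) (fun x => Φ.toFun (Fm m x)) u0 (um m))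
    (hconv : Filter.Tendsto (fun m => h21 T (fun x t => um m x t - ustar x t))
      Filter.atTop (nhds 0)) :
    Filter.Tendsto θm Filter.atTop (nhds θ₀) ∧
    Filter.Tendsto (fun m => l2T (fun x => Fm m x - F₀ x))
      Filter.atTop (nhds 0) := by
  have hβ' : d < 2 * β := by
    have h : (d : ℝ) < 2 * β := by linarith
    exact_mod_cast h
  have hjoint : Filter.Tendsto (fun m => (θm m, l2T fun x => Fm m x - F₀ x)) Filter.atTop
      (nhds (θ₀, 0)) := by
    refine Filter.tendsto_of_subseq_tendsto fun ns hns => ?_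
    obtain ⟨θ, hθmem, φ, hφ, hθlim⟩ := isCompact_Icc.tendsto_subseq fun n => hθm (ns n)
    have hw : ∀ n, SmoothQ fun x t => um (ns (φ n)) x t - ustar x t :=
      fun n => (hum _).1.sub hustar.1
    obtain ⟨ψ, hψ, hae⟩ := exists_subseq_tendsto_ae_of_h21 hw
      (hconv.comp (hns.comp hφ.tendsto_atTop))
    have h := inversion_of_tendsto_ae hT Φ hβ' hF₀ hF₀per hustar hpos hinj hθmem
      (hθlim.comp hψ.tendsto_atTop) (fun n => hFm (ns (φ (ψ n)))) (fun n => hum (ns (φ (ψ n)))) hae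
    exact ⟨φ ∘ ψ, h.1.prodMk_nhds h.2⟩
  exact ⟨hjoint.fst_nhds, hjoint.snd_nhds⟩
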